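/- arXiv:2409.19412 — 3 statements merged into one kernel-verified Lean document; each statement's English description precedes it below -/
import Mathlib

section
/- Let X be a real-valued random variable that is sub-Weibull with tail parameter θ > 0, i.e. there exist constants a, b > 0 with P(|X| ≥ x) ≤ a·exp(−b·x^{1/θ}) for all x ≥ 0. Then there exists a constant L > 1 (depending only on a, b, θ but not on q) such that for every integer q ≥ 2, E[|X|^q] ≤ L^{θ·q·ln q}. -/
open MeasureTheory

/-- A nonnegative random variable with tail `a * exp (-b * t)` has exponential moment of order
`b / 2` at most `1 + a`. -/
lemma integrable_exp_and_integral_le_of_tail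
    {Ω : Type*} [MeasurableSpace Ω] {μ : Measure Ω} [IsProbabilityMeasure μ]
    {Y : Ω → ℝ} (hY : Measurable Y) (hY0 : ∀ ω, 0 ≤ Y ω) {a b : ℝ} (ha : 0 < a) (hb : 0 < b)
    (htail : ∀ t : ℝ, 0 ≤ t → (μ {ω | t ≤ Y ω}).toReal ≤ a * Real.exp (-b * t)) :
    Integrable (fun ω => Real.exp (b / 2 * Y ω)) μ ∧
      ∫ ω, Real.exp (b / 2 * Y ω) ∂μ ≤ 1 + a := by
  have hprim : ∀ y : ℝ, ∫ t in (0 : ℝ)..y, b / 2 * Real.exp (b / 2 * t) =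
      Real.exp (b / 2 * y) - 1 := by
    intro y
    rw [intervalIntegral.integral_eq_sub_of_hasDerivAt (a := 0) (b := y)
      (f := fun t => Real.exp (b / 2 * t)) (f' := fun t => b / 2 * Real.exp (b / 2 * t))
      (fun t _ => by
        simpa [mul_comm] using ((hasDerivAt_id t).const_mul (b / 2)).exp)
      (Continuous.intervalIntegrable (by fun_prop) _ _)]
    simp
  have hlayer := lintegral_comp_eq_lintegral_meas_le_mul μ
    (f := Y) (g := fun t => b / 2 * Real.exp (b / 2 * t))
    (Filter.Eventually.of_forall hY0) hY.aemeasurable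
    (fun t _ => Continuous.intervalIntegrable (by fun_prop) _ _)
    (Filter.Eventually.of_forall fun t => by positivity)
  simp only [hprim] at hlayer
  have hexp : IntegrableOn (fun t : ℝ => a * (b / 2) * Real.exp (-(b / 2) * t)) (Set.Ioi 0) :=
    (integrableOn_exp_mul_Ioi (by linarith) 0).const_mul _
  have hbound : ∫⁻ ω, ENNReal.ofReal (Real.exp (b / 2 * Y ω) - 1) ∂μ ≤ ENNReal.ofReal a := by
    rw [hlayer]
    calc _ ≤ ∫⁻ t in Set.Ioi (0 : ℝ),
          ENNReal.ofReal (a * (b / 2) * Real.exp (-(b / 2) * t)) := by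
          refine setLIntegral_mono (by fun_prop) fun t ht => ?_
          rw [← ENNReal.ofReal_toReal (measure_ne_top μ {ω | t ≤ Y ω}),
            ← ENNReal.ofReal_mul ENNReal.toReal_nonneg]
          refine ENNReal.ofReal_le_ofReal ?_
          calc _ ≤ a * Real.exp (-b * t) * (b / 2 * Real.exp (b / 2 * t)) := by
                gcongr
                exact htail t (le_of_lt ht)
            _ = a * (b / 2) * (Real.exp (-b * t) * Real.exp (b / 2 * t)) := by ring
            _ = _ := by rw [← Real.exp_add]; ring_nf
      _ = ENNReal.ofReal a := by
          rw [← ofReal_integral_eq_lintegral_ofReal hexp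
            (Filter.Eventually.of_forall fun t => by positivity), integral_const_mul,
            integral_exp_mul_Ioi (by linarith)]
          congr 1
          simp
          field_simp
  have hnonneg : ∀ ω, 0 ≤ Real.exp (b / 2 * Y ω) - 1 := fun ω => by
    have := Real.one_le_exp (mul_nonneg (by linarith : 0 ≤ b / 2) (hY0 ω))
    linarith
  have hmeas : AEStronglyMeasurable (fun ω => Real.exp (b / 2 * Y ω) - 1) μ := by
    fun_prop
  have hint : Integrable (fun ω => Real.exp (b / 2 * Y ω) - 1) μ :=
    (lintegral_ofReal_ne_top_iff_integrable hmeas (Filter.Eventually.of_forall hnonneg)).1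
      (hbound.trans_lt ENNReal.ofReal_lt_top).ne
  have hint' : Integrable (fun ω => Real.exp (b / 2 * Y ω)) μ :=
    (hint.add (integrable_const (1 : ℝ))).congr
      (Filter.Eventually.of_forall fun ω => sub_add_cancel _ _)
  refine ⟨hint', ?_⟩
  have hle : ∫ ω, (Real.exp (b / 2 * Y ω) - 1) ∂μ ≤ a := by
    rw [integral_eq_lintegral_of_nonneg_ae (Filter.Eventually.of_forall hnonneg) hmeas]
    exact ENNReal.toReal_le_of_le_ofReal ha.le hbound
  rw [integral_sub hint' (integrable_const _)] at hle
  simp at hle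
  linarith

lemma rpow_le_div_rpow_mul_exp {c s y : ℝ} (hc : 0 < c) (hs : 0 < s) (hy : 0 ≤ y) :
    y ^ s ≤ (s / c) ^ s * Real.exp (c * y) := by
  have h : c * y / s ≤ Real.exp (c * y / s) := by
    linarith [Real.add_one_le_exp (c * y / s)]
  calc y ^ s = (s / c * (c * y / s)) ^ s := by congr 1; field_simp
    _ = (s / c) ^ s * (c * y / s) ^ s := Real.mul_rpow (by positivity) (by positivity)
    _ ≤ (s / c) ^ s * Real.exp (c * y / s) ^ s := by gcongr
    _ = (s / c) ^ s * Real.exp (c * y) := by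
      rw [← Real.exp_mul]; congr 2; field_simp

lemma exists_one_lt_mul_rpow_le_rpow_mul_log {θ c M : ℝ} (hθ : 0 < θ) (hc : 0 < c) (hM : 0 < M) :
    ∃ L : ℝ, 1 < L ∧ ∀ q : ℕ, 2 ≤ q →
      M * (θ * q / c) ^ (θ * q) ≤ L ^ (θ * q * Real.log q) := by
  have hlog2 : 0 < Real.log 2 := Real.log_pos (by norm_num)
  set A := |Real.log (θ / c)|
  set B := |Real.log M|
  refine ⟨Real.exp (1 + A / Real.log 2 + B / (θ * Real.log 2)),
    Real.one_lt_exp_iff.2 (by positivity), fun q hq => ?_⟩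
  have hq2 : (2 : ℝ) ≤ q := by exact_mod_cast hq
  have hq0 : (0 : ℝ) < q := by linarith
  have hlog : Real.log 2 ≤ Real.log q := Real.log_le_log (by norm_num) hq2
  have hbase : Real.log (θ * q / c) = Real.log (θ / c) + Real.log q := by
    rw [← Real.log_mul (by positivity) hq0.ne']; congr 1; ring
  rw [Real.rpow_def_of_pos (by positivity), hbase, ← Real.exp_mul]
  nth_rewrite 1 [← Real.exp_log hM]
  rw [← Real.exp_add, Real.exp_le_exp]
  have hA' : Real.log (θ / c) * (θ * q) ≤ A / Real.log 2 * (θ * q * Real.log q) :=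
    calc _ ≤ A * (θ * q) := by gcongr; exact le_abs_self _
      _ = A / Real.log 2 * (θ * q * Real.log 2) := by field_simp
      _ ≤ _ := by gcongr
  have hB' : Real.log M ≤ B / (θ * Real.log 2) * (θ * q * Real.log q) :=
    calc _ ≤ B := le_abs_self _
      _ = B / (θ * Real.log 2) * (θ * 1 * Real.log 2) := by field_simp
      _ ≤ _ := by gcongr; linarith
  linarith

/-- If a real random variable `X` is sub-Weibull with tail
parameter `θ > 0` (i.e. `P(|X| ≥ x) ≤ a·exp(−b·x^(1/θ))` for all `x ≥ 0`),
then there is a constant `L > 1`, independent of `q`, such that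
`E[|X|^q] ≤ L^(θ·q·ln q)` for every integer `q ≥ 2`. -/
theorem subWeibull_moment_bound
    {Ω : Type*} [MeasurableSpace Ω] (μ : Measure Ω) [IsProbabilityMeasure μ]
    (X : Ω → ℝ) (hX : Measurable X) (θ a b : ℝ)
    (hθ : 0 < θ) (ha : 0 < a) (hb : 0 < b)
    (htail : ∀ x : ℝ, 0 ≤ x →
      (μ {ω | x ≤ |X ω|}).toReal ≤ a * Real.exp (-b * x ^ (1 / θ))) :
    ∃ L : ℝ, 1 < L ∧ ∀ q : ℕ, 2 ≤ q →
      (∫ ω, |X ω| ^ q ∂μ) ≤ L ^ (θ * q * Real.log q) := by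
  obtain ⟨L, hL, hLq⟩ := exists_one_lt_mul_rpow_le_rpow_mul_log hθ (half_pos hb)
    (by linarith : 0 < 1 + a)
  refine ⟨L, hL, fun q hq => le_trans ?_ (hLq q hq)⟩
  have hY0 : ∀ ω, 0 ≤ |X ω| ^ (1 / θ) := fun ω => by positivity
  obtain ⟨hint, hle⟩ := integrable_exp_and_integral_le_of_tail (μ := μ)
    (Y := fun ω => |X ω| ^ (1 / θ)) (by fun_prop) hY0 ha hb fun t ht => by
      have hset : {ω | t ≤ |X ω| ^ (1 / θ)} = {ω | t ^ θ ≤ |X ω|} := by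
        ext ω
        simp only [Set.mem_ofPred_eq, one_div]
        exact Real.le_rpow_inv_iff_of_pos ht (abs_nonneg _) hθ
      have h := htail (t ^ θ) (by positivity)
      rwa [← Real.rpow_mul ht, mul_one_div_cancel hθ.ne', Real.rpow_one, ← hset] at h
  have hq0 : (0 : ℝ) < q := by exact_mod_cast (by omega : 0 < q)
  have hpt : ∀ ω, |X ω| ^ q ≤
      (θ * q / (b / 2)) ^ (θ * q) * Real.exp (b / 2 * |X ω| ^ (1 / θ)) := fun ω => by
    have h := rpow_le_div_rpow_mul_exp (half_pos hb) (mul_pos hθ hq0) (hY0 ω)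
    rwa [← Real.rpow_mul (abs_nonneg _), ← mul_assoc, one_div_mul_cancel hθ.ne', one_mul,
      Real.rpow_natCast] at h
  calc ∫ ω, |X ω| ^ q ∂μ
      ≤ ∫ ω, (θ * q / (b / 2)) ^ (θ * q) * Real.exp (b / 2 * |X ω| ^ (1 / θ)) ∂μ :=
        integral_mono_of_nonneg (Filter.Eventually.of_forall fun ω => by positivity)
          (hint.const_mul _) (Filter.Eventually.of_forall hpt)
    _ = (θ * q / (b / 2)) ^ (θ * q) * ∫ ω, Real.exp (b / 2 * |X ω| ^ (1 / θ)) ∂μ :=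
        integral_const_mul _ _
    _ ≤ (θ * q / (b / 2)) ^ (θ * q) * (1 + a) := by gcongr
    _ = (1 + a) * (θ * q / (b / 2)) ^ (θ * q) := mul_comm _ _
end

section
/- Let n be an ℕ-valued random variable with E[n] > 0 that is sub-Weibull with tail parameter θ > 0, i.e. there exist a, b > 0 with P(n ≥ x) ≤ a·exp(−b·x^{1/θ}) for all x ≥ 0, and let c > 0 and ν > 1. Then it is impossible that F_q := E[n(n−1)⋯(n−q+1)]/E[n]^q ≥ exp(c·(q−1)^ν) holds for all integers q ≥ 2; i.e., there exists some q ≥ 2 for which this inequality fails. -/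
open MeasureTheory

open Filter Topology in
/-- Factorial growth of a multiple of `q` is beaten, for some `q`, by a stretched
exponential of exponent larger than one. -/
theorem exists_factorial_growth_lt_exp_rpow (A B M c ν : ℝ) (m : ℕ) (hm : 1 ≤ m) (hA : 0 < A)
    (hB : 0 < B) (hM : 0 < M) (hc : 0 < c) (hν : 1 < ν) :
    ∃ q : ℕ, 2 ≤ q ∧
      A * ((m * (q + 2)).factorial * B ^ (m * (q + 2))) / M ^ q <
        Real.exp (c * ((q : ℝ) - 1) ^ ν) := by
  have hm0 : (0 : ℝ) < m := by exact_mod_cast hm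
  set D : ℝ := |Real.log A| + |Real.log B| + |Real.log M| with hD
  set c' : ℝ := c / (2 * m) ^ ν with hc'
  have hc'0 : 0 < c' := by positivity
  have hlog : ∀ᶠ x : ℝ in atTop, Real.log x + D < c' * x ^ (ν - 1) := by
    have h1 := (isLittleO_log_rpow_atTop (sub_pos.2 hν)).def (half_pos hc'0)
    have h2 := (tendsto_rpow_atTop (sub_pos.2 hν)).eventually_gt_atTop (D / (c' / 2))
    filter_upwards [h1, h2, eventually_gt_atTop 0] with x hx1 hx2 hx0
    rw [div_lt_iff₀ (half_pos hc'0)] at hx2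
    rw [Real.norm_eq_abs, Real.norm_eq_abs, abs_of_nonneg (Real.rpow_nonneg hx0.le _)] at hx1
    linarith [le_abs_self (Real.log x)]
  have htend : Tendsto (fun q : ℕ => ((m * (q + 2) : ℕ) : ℝ)) atTop atTop := by
    refine tendsto_natCast_atTop_atTop.comp (tendsto_atTop_mono (fun q => ?_) tendsto_id)
    simp only [id]
    nlinarith
  obtain ⟨q, hq, hq4⟩ := ((htend.eventually hlog).and (eventually_ge_atTop 4)).exists
  refine ⟨q, by omega, ?_⟩
  have hq4' : (4 : ℝ) ≤ q := by exact_mod_cast hq4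
  set N : ℕ := m * (q + 2) with hN
  have hNq : (q : ℝ) ≤ N := by
    exact_mod_cast (show q ≤ N by rw [hN]; nlinarith)
  have hN0 : (0 : ℝ) < N := by linarith
  have hNpow : c' * (N : ℝ) ^ ν ≤ c * ((q : ℝ) - 1) ^ ν := by
    have h1 : (N : ℝ) ≤ 2 * m * ((q : ℝ) - 1) := by
      rw [hN]; push_cast; nlinarith
    have h2 : (N : ℝ) ^ ν ≤ (2 * m) ^ ν * ((q : ℝ) - 1) ^ ν := by
      rw [← Real.mul_rpow (by positivity) (by linarith)]
      exact Real.rpow_le_rpow hN0.le h1 (by linarith)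
    rw [hc', div_mul_eq_mul_div, div_le_iff₀ (by positivity)]
    nlinarith
  have hsplit : (N : ℝ) ^ ν = N * (N : ℝ) ^ (ν - 1) := by
    rw [Real.rpow_sub_one hN0.ne']; field_simp
  have hfac : ((N.factorial : ℕ) : ℝ) ≤ (N : ℝ) ^ N := by exact_mod_cast N.factorial_le_pow
  calc A * (N.factorial * B ^ N) / M ^ q ≤ A * ((N : ℝ) ^ N * B ^ N) / M ^ q := by gcongr
    _ = Real.exp (Real.log A + (N * Real.log N + N * Real.log B) - q * Real.log M) := by
      rw [Real.exp_sub, Real.exp_add, Real.exp_add, Real.exp_log hA, Real.exp_nat_mul,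
        Real.exp_nat_mul, Real.exp_nat_mul, Real.exp_log hN0, Real.exp_log hB, Real.exp_log hM]
    _ < Real.exp (c * ((q : ℝ) - 1) ^ ν) := by
      refine Real.exp_lt_exp.2 (lt_of_lt_of_le ?_ hNpow)
      have h1 : Real.log A ≤ N * |Real.log A| := by
        nlinarith [le_abs_self (Real.log A), abs_nonneg (Real.log A)]
      have h2 : N * Real.log B ≤ N * |Real.log B| := by
        gcongr; exact le_abs_self _
      have h3 : -(q * Real.log M) ≤ N * |Real.log M| := by
        nlinarith [neg_abs_le (Real.log M), abs_nonneg (Real.log M)]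
      have h4 := mul_lt_mul_of_pos_left hq hN0
      rw [hsplit, hD] at *
      nlinarith

/-- Pointwise decay of `k ^ q * exp (-b * k ^ (1 / θ))`. -/
theorem pow_mul_exp_neg_rpow_le {θ b : ℝ} (hθ : 0 < θ) (hb : 0 < b) {m : ℕ} (hm : θ ≤ m)
    {q : ℕ} (hq : q ≠ 0) (k : ℕ) :
    (k : ℝ) ^ q * Real.exp (-b * (k : ℝ) ^ (1 / θ)) ≤
      (m * (q + 2)).factorial * b⁻¹ ^ (m * (q + 2)) * (1 / (k : ℝ) ^ 2) := by
  rcases Nat.eq_zero_or_pos k with rfl | hk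
  · simp [hq]
  have hk1 : (1 : ℝ) ≤ k := by exact_mod_cast hk
  have hk0 : (0 : ℝ) < k := by linarith
  set N := m * (q + 2) with hN
  set y : ℝ := (k : ℝ) ^ (1 / θ) with hy
  have hy0 : 0 < y := Real.rpow_pos_of_pos hk0 _
  have hyN : (k : ℝ) ^ (q + 2) ≤ y ^ N := by
    rw [← Real.rpow_natCast, hy, ← Real.rpow_mul_natCast hk0.le]
    refine Real.rpow_le_rpow_of_exponent_le hk1 ?_
    rw [hN, one_div, inv_mul_eq_div, le_div_iff₀ hθ]
    push_cast
    nlinarith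
  have hexp := Real.pow_div_factorial_le_exp (b * y) (by positivity) N
  have hfac : (0 : ℝ) < N.factorial := by exact_mod_cast N.factorial_pos
  rw [neg_mul, Real.exp_neg, ← div_eq_mul_inv, div_le_iff₀ (Real.exp_pos _)]
  calc (k : ℝ) ^ q = (k : ℝ) ^ (q + 2) * (1 / (k : ℝ) ^ 2) := by
        rw [pow_add]; field_simp
    _ ≤ y ^ N * (1 / (k : ℝ) ^ 2) := by gcongr
    _ = N.factorial * b⁻¹ ^ N * (1 / (k : ℝ) ^ 2) * ((b * y) ^ N / N.factorial) := by
        rw [mul_pow, inv_pow]; field_simp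
    _ ≤ _ := by gcongr

/-- Factorial moments of a sub-Weibull `ℕ`-valued random variable. -/
theorem integral_descFactorial_le_of_subWeibull
    {Ω : Type*} [MeasurableSpace Ω] (μ : Measure Ω) [IsProbabilityMeasure μ]
    (n : Ω → ℕ) (hn : Measurable n) {θ a b : ℝ} (hθ : 0 < θ) (ha : 0 < a) (hb : 0 < b)
    (htail : ∀ x : ℝ, 0 ≤ x →
      (μ {ω | x ≤ (n ω : ℝ)}).toReal ≤ a * Real.exp (-b * x ^ (1 / θ)))
    {m : ℕ} (hm : θ ≤ m) {q : ℕ} (hq : q ≠ 0) :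
    ∫ ω, ((n ω).descFactorial q : ℝ) ∂μ ≤
      a * (∑' k : ℕ, 1 / (k : ℝ) ^ 2) * ((m * (q + 2)).factorial * b⁻¹ ^ (m * (q + 2))) := by
  set C : ℝ := (m * (q + 2)).factorial * b⁻¹ ^ (m * (q + 2)) with hC
  have hC0 : 0 ≤ C := by positivity
  have hS0 : 0 ≤ ∑' k : ℕ, 1 / (k : ℝ) ^ 2 := tsum_nonneg fun k => by positivity
  have hmap : ∫ ω, ((n ω).descFactorial q : ℝ) ∂μ =
      ∫ k, (k.descFactorial q : ℝ) ∂(μ.map n) :=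
    (integral_map hn.aemeasurable (measurable_of_countable
      (fun k : ℕ => (k.descFactorial q : ℝ))).aestronglyMeasurable).symm
  rw [hmap]
  by_cases hint : Integrable (fun k : ℕ => (k.descFactorial q : ℝ)) (μ.map n)
  swap
  · rw [integral_undef hint]; positivity
  rw [integral_countable hint]
  have hterm : ∀ k : ℕ, (μ.map n).real {k} • (k.descFactorial q : ℝ) ≤
      a * C * (1 / (k : ℝ) ^ 2) := by
    intro k
    have h1 : (μ.map n).real {k} ≤ a * Real.exp (-b * (k : ℝ) ^ (1 / θ)) := by
      refine le_trans ?_ (htail k (by positivity))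
      rw [map_measureReal_apply hn (measurableSet_singleton k)]
      refine measureReal_mono fun ω hω => ?_
      simp only [Set.mem_preimage, Set.mem_singleton_iff] at hω
      simp [hω]
    have h2 : (k.descFactorial q : ℝ) ≤ (k : ℝ) ^ q := by
      exact_mod_cast k.descFactorial_le_pow q
    calc (μ.map n).real {k} • (k.descFactorial q : ℝ)
        ≤ (a * Real.exp (-b * (k : ℝ) ^ (1 / θ))) * (k : ℝ) ^ q := by
          rw [smul_eq_mul]; gcongr
      _ = a * ((k : ℝ) ^ q * Real.exp (-b * (k : ℝ) ^ (1 / θ))) := by ring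
      _ ≤ a * (C * (1 / (k : ℝ) ^ 2)) := by
          exact mul_le_mul_of_nonneg_left (pow_mul_exp_neg_rpow_le hθ hb hm hq k) ha.le
      _ = _ := by ring
  have hsum : Summable fun k : ℕ => a * C * (1 / (k : ℝ) ^ 2) :=
    (Real.summable_one_div_nat_pow.2 one_lt_two).mul_left _
  calc ∑' k : ℕ, (μ.map n).real {k} • (k.descFactorial q : ℝ)
      ≤ ∑' k : ℕ, a * C * (1 / (k : ℝ) ^ 2) :=
        (hsum.of_nonneg_of_le (fun k => by positivity) hterm).tsum_le_tsum hterm hsum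
    _ = _ := by rw [tsum_mul_left]; ring

/-- If an `ℕ`-valued random variable `n` with `E[n] > 0` is
sub-Weibull with tail parameter `θ > 0`, and `c > 0`, `ν > 1`, then the
normalized factorial moments `F_q = E[n(n−1)⋯(n−q+1)]/E[n]^q` cannot satisfy
`F_q ≥ exp(c·(q−1)^ν)` for all integers `q ≥ 2`: there is some `q ≥ 2` for
which this inequality fails. -/
theorem subWeibull_not_stretched_exp_factorialMoment
    {Ω : Type*} [MeasurableSpace Ω] (μ : Measure Ω) [IsProbabilityMeasure μ]
    (n : Ω → ℕ) (hn : Measurable n) (θ a b c ν : ℝ)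
    (hθ : 0 < θ) (ha : 0 < a) (hb : 0 < b) (hc : 0 < c) (hν : 1 < ν)
    (hmean : 0 < ∫ ω, (n ω : ℝ) ∂μ)
    (htail : ∀ x : ℝ, 0 ≤ x →
      (μ {ω | x ≤ (n ω : ℝ)}).toReal ≤ a * Real.exp (-b * x ^ (1 / θ))) :
    ∃ q : ℕ, 2 ≤ q ∧
      (∫ ω, ((n ω).descFactorial q : ℝ) ∂μ) / (∫ ω, (n ω : ℝ) ∂μ) ^ q <
        Real.exp (c * ((q : ℝ) - 1) ^ ν) := by
  have hS : 0 < ∑' k : ℕ, 1 / (k : ℝ) ^ 2 :=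
    (Real.summable_one_div_nat_pow.2 one_lt_two).tsum_pos (fun k => by positivity) 1 (by simp)
  obtain ⟨q, hq, hlt⟩ := exists_factorial_growth_lt_exp_rpow
    (a * ∑' k : ℕ, 1 / (k : ℝ) ^ 2) b⁻¹ (∫ ω, (n ω : ℝ) ∂μ) c ν ⌈θ⌉₊
    (Nat.ceil_pos.2 hθ) (mul_pos ha hS) (inv_pos.2 hb) hmean hc hν
  refine ⟨q, hq, lt_of_le_of_lt ?_ hlt⟩
  gcongr
  exact integral_descFactorial_le_of_subWeibull μ n hn hθ ha hb htail (Nat.le_ceil θ) (by omega)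
end

section
/- Let λ > 0 and let n follow the Poisson distribution with parameter λ, i.e. P(n = k) = e^{−λ}·λ^k/k! for k ∈ ℕ. Then for every integer q ≥ 1, E[n^q] ≤ (q·(1+λ))^q. In particular, the Poisson distribution satisfies the sub-Weibull moment growth bound E[n^q] ≤ L^{q·ln q} for a suitable constant L > 1 depending only on λ, i.e. it is sub-Weibull with tail parameter θ = 1. -/
/-- If `1 ≤ t * c`, the `q`-th power is dominated by an exponential of rate `t`. -/
lemma natCast_pow_le_mul_exp {c t : ℝ} (hc : 0 < c) (htc : 1 ≤ t * c) {q : ℕ} (hq : 1 ≤ q)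
    (k : ℕ) : (k : ℝ) ^ q ≤ (q * c) ^ q * (Real.exp (-q) * Real.exp t ^ k) := by
  have hq0 : (0 : ℝ) < q := by exact_mod_cast hq
  have hk : (k : ℝ) ≤ q * c * Real.exp (k * t / q - 1) := by
    have h := Real.add_one_le_exp (k * t / q - 1)
    calc (k : ℝ) ≤ k * (t * c) := le_mul_of_one_le_right k.cast_nonneg htc
      _ = q * c * (k * t / q - 1 + 1) := by field_simp; ring
      _ ≤ _ := by gcongr
  calc (k : ℝ) ^ q ≤ (q * c * Real.exp (k * t / q - 1)) ^ q := by gcongr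
    _ = _ := by
      rw [mul_pow, ← Real.exp_nat_mul, ← Real.exp_nat_mul, ← Real.exp_add]
      congr 2
      field_simp
      ring

/-- The probability generating function of the Poisson distribution. -/
lemma hasSum_pow_mul_poisson (lam x : ℝ) :
    HasSum (fun k : ℕ => x ^ k * (Real.exp (-lam) * lam ^ k / k.factorial))
      (Real.exp (-lam) * Real.exp (x * lam)) := by
  have h := (NormedSpace.expSeries_div_hasSum_exp (x * lam)).mul_left (Real.exp (-lam))
  rw [← Real.exp_eq_exp_ℝ] at h
  refine h.congr_fun fun k => ?_
  rw [mul_pow]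
  ring

lemma one_le_log_one_add_div_mul {lam q : ℝ} (hlam : 0 < lam) (hq : 1 ≤ q) :
    1 ≤ Real.log (1 + q / lam) * (1 + lam) := by
  have hq0 : 0 < q := by linarith
  have h := Real.one_sub_inv_le_log_of_pos (show 0 < 1 + q / lam by positivity)
  have h' : 1 ≤ (1 - (1 + q / lam)⁻¹) * (1 + lam) := by
    have : (1 - (1 + q / lam)⁻¹) * (1 + lam) = q * (1 + lam) / (lam + q) := by
      field_simp
      ring
    rw [this, le_div_iff₀ (by positivity)]
    nlinarith
  exact h'.trans (by gcongr)

lemma poisson_moment_summable_and_le {lam : ℝ} (hlam : 0 < lam) {q : ℕ} (hq : 1 ≤ q) :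
    Summable (fun k : ℕ => (k : ℝ) ^ q * (Real.exp (-lam) * lam ^ k / k.factorial)) ∧
      (∑' k : ℕ, (k : ℝ) ^ q * (Real.exp (-lam) * lam ^ k / k.factorial)) ≤
        ((q : ℝ) * (1 + lam)) ^ q := by
  have hx : 0 < 1 + (q : ℝ) / lam := by positivity
  have hs : HasSum (fun k : ℕ => ((q : ℝ) * (1 + lam)) ^ q * Real.exp (-q) *
      ((1 + (q : ℝ) / lam) ^ k * (Real.exp (-lam) * lam ^ k / k.factorial)))
      (((q : ℝ) * (1 + lam)) ^ q) := by
    have h := (hasSum_pow_mul_poisson lam (1 + q / lam)).mul_left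
      (((q : ℝ) * (1 + lam)) ^ q * Real.exp (-q))
    have hexp : -(q : ℝ) + (-lam + (1 + q / lam) * lam) = 0 := by
      field_simp
      ring
    rwa [mul_assoc _ (Real.exp (-q)), ← Real.exp_add, ← Real.exp_add, hexp, Real.exp_zero,
      mul_one] at h
  have hle (k : ℕ) : (k : ℝ) ^ q * (Real.exp (-lam) * lam ^ k / k.factorial) ≤
      ((q : ℝ) * (1 + lam)) ^ q * Real.exp (-q) *
        ((1 + (q : ℝ) / lam) ^ k * (Real.exp (-lam) * lam ^ k / k.factorial)) := by
    have h := natCast_pow_le_mul_exp (by positivity)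
      (one_le_log_one_add_div_mul hlam (by exact_mod_cast hq : (1 : ℝ) ≤ q)) hq k
    rw [Real.exp_log hx, ← mul_assoc] at h
    rw [← mul_assoc _ ((1 + (q : ℝ) / lam) ^ k)]
    gcongr
  have hsum := Summable.of_nonneg_of_le (fun k => by positivity) hle hs.summable
  exact ⟨hsum, hasSum_le hle hsum.hasSum hs⟩

lemma mul_pow_le_exp_rpow_mul_log {c : ℝ} (hc : 1 ≤ c) {q : ℕ} (hq : 2 ≤ q) :
    ((q : ℝ) * c) ^ q ≤
      Real.exp (1 + Real.log c / Real.log 2) ^ ((q : ℝ) * Real.log q) := by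
  have hq2 : (2 : ℝ) ≤ q := by exact_mod_cast hq
  have hc0 : 0 < c := by linarith
  have hl2 : 0 < Real.log 2 := Real.log_pos one_lt_two
  have hlog : Real.log 2 ≤ Real.log q := Real.log_le_log two_pos hq2
  have hlogc : 0 ≤ Real.log c := Real.log_nonneg hc
  have hmain : Real.log c ≤ Real.log c / Real.log 2 * Real.log q := by
    rw [div_mul_eq_mul_div, le_div_iff₀ hl2]
    gcongr
  rw [← Real.exp_mul, ← Real.exp_log (show 0 < (q : ℝ) * c by positivity), ← Real.exp_nat_mul,
    Real.exp_le_exp, Real.log_mul (by positivity) hc0.ne']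
  calc (q : ℝ) * (Real.log q + Real.log c)
      ≤ q * (Real.log q + Real.log c / Real.log 2 * Real.log q) := by gcongr
    _ = _ := by ring

/-- For the Poisson distribution with parameter `λ > 0`,
with mass function `P(k) = e^(−λ)·λ^k/k!`, the ordinary moments satisfy
`E[n^q] ≤ (q·(1+λ))^q` for every integer `q ≥ 1`. In particular, Poisson
satisfies the sub-Weibull moment growth with tail parameter `θ = 1`:
there is a constant `L > 1`, depending only on `λ`, with
`E[n^q] ≤ L^(q·ln q)` for every integer `q ≥ 2`. -/
theorem poisson_moment_growth
    (lam : ℝ) (hlam : 0 < lam) (P : ℕ → ℝ)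
    (hP : P = fun k : ℕ => Real.exp (-lam) * lam ^ k / k.factorial) :
    (∀ q : ℕ, 1 ≤ q →
      Summable (fun k : ℕ => (k : ℝ) ^ q * P k) ∧
        (∑' k : ℕ, (k : ℝ) ^ q * P k) ≤ ((q : ℝ) * (1 + lam)) ^ q) ∧
      ∃ L : ℝ, 1 < L ∧ ∀ q : ℕ, 2 ≤ q →
        (∑' k : ℕ, (k : ℝ) ^ q * P k) ≤ L ^ ((q : ℝ) * Real.log q) := by
  subst hP
  refine ⟨fun q hq => poisson_moment_summable_and_le hlam hq,
    Real.exp (1 + Real.log (1 + lam) / Real.log 2), ?_, fun q hq => ?_⟩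
  · have := Real.log_pos one_lt_two
    have := Real.log_pos (show 1 < 1 + lam by linarith)
    exact Real.one_lt_exp_iff.2 (by positivity)
  · exact (poisson_moment_summable_and_le hlam (by omega)).2.trans
      (mul_pow_le_exp_rpow_mul_log (by linarith) hq)
end
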